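/- Let φ = (φ_1, ..., φ_r) be a tuple of real polynomials in N variables, q a single real polynomial in N variables, and F a real polynomial. Suppose F attains only finitely many values on the real zero set {z ∈ ℝ^N : φ(z) = 0}, the set K_2 := {z ∈ ℝ^N : φ(z) = 0, q(z) ≥ 0} is nonempty, and f* is the minimum value of F on K_2. Then there exists an integer k_2 such that, for every ε > 0, F − (f* − ε) ∈ Ideal(φ)_{2k_2} + Qmod(q)_{2k_2}, i.e. F − f* + ε = Σ_i φ_i p_i + σ_0 + q·σ_1 with deg(φ_i p_i) ≤ 2k_2 and σ_0, σ_1 sums of squares with deg σ_0 ≤ 2k_2 and deg(q σ_1) ≤ 2k_2. Consequently, the k-th SOS bound f_k := sup{γ : F − γ ∈ Ideal(φ)_{2k} + Qmod(q)_{2k}} equals f* for all k ≥ k_2. -/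

import Mathlib

open MvPolynomial

/-- A sum of squares of polynomials. -/
def IsSOS {σ : Type} (p : MvPolynomial σ ℝ) : Prop :=
  ∃ (t : ℕ) (s : Fin t → MvPolynomial σ ℝ), p = ∑ i, s i ^ 2

/-- Membership in `Ideal(φ)_{2k} + Qmod(q)_{2k}` for a single inequality `q`:
`f = Σᵢ φᵢ pᵢ + σ₀ + q σ₁` with `deg(φᵢ pᵢ) ≤ 2k`, `σ₀, σ₁` sums of squares,
`deg σ₀ ≤ 2k` and `deg(q σ₁) ≤ 2k`. -/
def InIQ1Trunc {σ : Type} {ι : Type*} [Fintype ι] (k : ℕ)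
    (φ : ι → MvPolynomial σ ℝ) (q : MvPolynomial σ ℝ) (f : MvPolynomial σ ℝ) : Prop :=
  ∃ (p : ι → MvPolynomial σ ℝ) (σ0 σ1 : MvPolynomial σ ℝ),
    IsSOS σ0 ∧ IsSOS σ1 ∧ (∀ i, (φ i * p i).totalDegree ≤ 2 * k) ∧
    σ0.totalDegree ≤ 2 * k ∧ (q * σ1).totalDegree ≤ 2 * k ∧
    f = ∑ i, φ i * p i + σ0 + q * σ1

namespace Polynomial

/-- The intermediate value property for polynomials over an ordered field. -/
def IVP (R : Type*) [Field R] [LinearOrder R] : Prop :=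
  ∀ (f : R[X]) (a b : R), a < b → f.eval a < 0 → 0 < f.eval b →
    ∃ c, a < c ∧ c < b ∧ f.eval c = 0

variable {R : Type*} [Field R] [LinearOrder R] [IsStrictOrderedRing R]

theorem IVP.exists_root_of_mul_neg (hR : IVP R) {f : R[X]} {a b : R} (hab : a < b)
    (h : f.eval a * f.eval b < 0) : ∃ c, a < c ∧ c < b ∧ f.eval c = 0 := by
  rcases mul_neg_iff.1 h with ⟨h1, h2⟩ | ⟨h1, h2⟩
  · obtain ⟨c, h3, h4, h5⟩ := hR (-f) a b hab (by simpa using h1) (by simpa using h2)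
    exact ⟨c, h3, h4, by simpa using h5⟩
  · exact hR f a b hab h1 h2

theorem IVP.rolle_aux (hR : IVP R) {f : R[X]} (hf : f ≠ 0) {a b : R} (hab : a < b)
    (ha : f.eval a = 0) (hb : f.eval b = 0) (hno : ∀ c, a < c → c < b → f.eval c ≠ 0) :
    ∃ c, a < c ∧ c < b ∧ f.derivative.eval c = 0 := by
  obtain ⟨q, hq, hqa⟩ := exists_eq_pow_rootMultiplicity_mul_and_not_dvd f hf a
  have hq0 : q ≠ 0 := by rintro rfl; simp at hqa
  obtain ⟨g, hg, hgb⟩ := exists_eq_pow_rootMultiplicity_mul_and_not_dvd q hq0 b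
  rw [dvd_iff_isRoot, IsRoot.def] at hqa hgb
  have hm : rootMultiplicity a f ≠ 0 := ((rootMultiplicity_pos hf).2 ha).ne'
  have hqb : q.eval b = 0 := by
    rw [hq, eval_mul, eval_pow] at hb
    have : (X - C a).eval b ≠ 0 := by simp [sub_ne_zero, hab.ne']
    exact (mul_eq_zero.1 hb).resolve_left (pow_ne_zero _ this)
  have hn : rootMultiplicity b q ≠ 0 := ((rootMultiplicity_pos hq0).2 hqb).ne'
  obtain ⟨m, hm⟩ := Nat.exists_eq_succ_of_ne_zero hm
  obtain ⟨n, hn⟩ := Nat.exists_eq_succ_of_ne_zero hn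
  rw [hm] at hq
  rw [hn] at hg
  have hga : g.eval a ≠ 0 := by
    intro h
    rw [hg] at hqa
    simp [h] at hqa
  have hgab : 0 < g.eval a * g.eval b := by
    rcases lt_trichotomy (g.eval a * g.eval b) 0 with h | h | h
    · obtain ⟨c, h1, h2, h3⟩ := hR.exists_root_of_mul_neg hab h
      exact absurd (by rw [hq, hg]; simp [h3]) (hno c h1 h2)
    · simp_all
    · exact h
  let B : R[X] := C (m + 1 : R) * ((X - C b) * g) + C (n + 1 : R) * ((X - C a) * g)
    + (X - C a) * (X - C b) * derivative g
  have hB : derivative f = (X - C a) ^ m * (X - C b) ^ n * B := by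
    rw [hq, hg]
    simp only [derivative_mul, derivative_X_sub_C_pow, B]
    push_cast
    simp
    ring
  have hBab : B.eval a * B.eval b < 0 := by
    have : B.eval a * B.eval b
        = -((m + 1) * (n + 1) * (b - a) ^ 2 * (g.eval a * g.eval b)) := by
      simp [B]; ring
    rw [this, neg_lt_zero]
    have := sub_pos.2 hab
    positivity
  obtain ⟨c, h1, h2, h3⟩ := hR.exists_root_of_mul_neg hab hBab
  exact ⟨c, h1, h2, by rw [hB]; simp [h3]⟩

theorem IVP.rolle (hR : IVP R) {f : R[X]} {a b : R} (hab : a < b)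
    (ha : f.eval a = 0) (hb : f.eval b = 0) :
    ∃ c, a < c ∧ c < b ∧ f.derivative.eval c = 0 := by
  by_cases hf : f = 0
  · exact ⟨(a + b) / 2, by linarith, by linarith, by simp [hf]⟩
  let s := f.roots.toFinset.filter (a < ·)
  have hs : s.Nonempty := ⟨b, by simp [s, hf, hb, hab]⟩
  obtain ⟨b', hb's, hmin⟩ := s.exists_min_image id hs
  have hb' : f.eval b' = 0 ∧ a < b' := by simpa [s, hf] using hb's
  have hb'b : b' ≤ b := hmin b (by simp [s, hf, hb, hab])
  obtain ⟨c, h1, h2, h3⟩ := hR.rolle_aux hf hb'.2 ha hb'.1 fun c h1 h2 h3 ↦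
    absurd (hmin c (by simp [s, hf, h3, h1])) (by simpa using h2)
  exact ⟨c, h1, h2.trans_le hb'b, h3⟩

theorem IVP.mean_value (hR : IVP R) (f : R[X]) {a b : R} (hab : a < b) :
    ∃ c, a < c ∧ c < b ∧ f.eval b - f.eval a = f.derivative.eval c * (b - a) := by
  obtain ⟨c, h1, h2, h3⟩ := hR.rolle
    (f := C (b - a) * (f - C (f.eval a)) - C (f.eval b - f.eval a) * (X - C a)) hab
    (by simp) (by simp; ring)
  refine ⟨c, h1, h2, ?_⟩
  simp at h3
  linear_combination -h3

theorem IVP.eval_lt_eval (hR : IVP R) {f : R[X]} {a b x y : R}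
    (hf : ∀ c, a < c → c < b → 0 < f.derivative.eval c) (hx : a ≤ x) (hxy : x < y) (hy : y ≤ b) :
    f.eval x < f.eval y := by
  obtain ⟨c, h1, h2, h3⟩ := hR.mean_value f hxy
  have := mul_pos (hf c (hx.trans_lt h1) (h2.trans_le hy)) (sub_pos.2 hxy)
  linarith

theorem ivp_real : IVP ℝ := by
  intro f a b hab ha hb
  obtain ⟨c, hc, h⟩ := intermediate_value_Ioo hab.le f.continuous.continuousOn ⟨ha, hb⟩
  exact ⟨c, hc.1, hc.2, h⟩

open Filter SignType

section EventualSign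

variable {R : Type*} [Field R] [LinearOrder R] [IsStrictOrderedRing R]

theorem eventually_le_eval_of_leadingCoeff_pos (n : ℕ) (p : R[X]) (hn : p.natDegree = n)
    (hp : 0 < p.leadingCoeff) : ∃ c, 0 < c ∧ ∀ᶠ x in atTop, c ≤ p.eval x := by
  induction n generalizing p with
  | zero =>
    rw [natDegree_eq_zero] at hn
    obtain ⟨a, rfl⟩ := hn
    exact ⟨a, by simpa using hp, by simp⟩
  | succ n ih =>
    have hdeg : p.divX.natDegree = n := by rw [natDegree_divX_eq_natDegree_tsub_one, hn]; rfl
    obtain ⟨c, hc, h⟩ := ih p.divX hdeg (by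
      rwa [leadingCoeff, hdeg, coeff_divX, ← hn])
    refine ⟨c, hc, ?_⟩
    filter_upwards [h, eventually_ge_atTop 0, eventually_ge_atTop (1 - p.coeff 0 / c)]
      with x h0 h1 h2
    rw [← divX_mul_X_add p]
    simp only [eval_add, eval_mul, eval_X, eval_C]
    have h3 := mul_le_mul_of_nonneg_right h0 h1
    have h4 := mul_le_mul_of_nonneg_left h2 hc.le
    have h5 : c * (1 - p.coeff 0 / c) = c - p.coeff 0 := by field_simp
    linarith

theorem eventually_sign_eval (p : R[X]) :
    ∀ᶠ x in atTop, sign (p.eval x) = sign p.leadingCoeff := by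
  rcases lt_trichotomy p.leadingCoeff 0 with h | h | h
  · obtain ⟨c, hc, h'⟩ := eventually_le_eval_of_leadingCoeff_pos _ (-p) rfl (by simpa using h)
    filter_upwards [h'] with x hx
    rw [sign_neg h, sign_neg]
    simp at hx
    linarith
  · simp [leadingCoeff_eq_zero.1 h]
  · obtain ⟨c, hc, h'⟩ := eventually_le_eval_of_leadingCoeff_pos _ p rfl h
    filter_upwards [h'] with x hx
    rw [sign_pos h, sign_pos (hc.trans_le hx)]

end EventualSign

section SamePosition

variable {R S : Type*} [LinearOrder R] [LinearOrder S]

/-- `x` and `y` occupy the same position relative to the matched pairs in `Z`. -/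
def SamePosition (Z : Set (R × S)) (x : R) (y : S) : Prop :=
  ∀ p ∈ Z, (x < p.1 ↔ y < p.2) ∧ (p.1 < x ↔ p.2 < y)

theorem SamePosition.anti {Z Z' : Set (R × S)} (h : Z ⊆ Z') {x : R} {y : S}
    (hxy : SamePosition Z' x y) : SamePosition Z x y := fun p hp ↦ hxy p (h hp)

theorem SamePosition.eq_of_mem {Z : Set (R × S)} {x : R} {y : S} (h : SamePosition Z x y)
    {p : R × S} (hp : p ∈ Z) (hx : p.1 = x) : p.2 = y := by
  obtain ⟨h1, h2⟩ := h p hp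
  simp only [hx, lt_irrefl, false_iff, not_lt] at h1 h2
  exact le_antisymm h1 h2

/-- A finite set of pairs which is the graph of a strictly monotone map. -/
structure IsMatching (Z : Set (R × S)) : Prop where
  finite : Z.Finite
  samePosition : ∀ p ∈ Z, SamePosition Z p.1 p.2

theorem IsMatching.exists_gap {Z : Set (R × S)} (hZ : IsMatching Z) {l u : R × S} (hl : l ∈ Z)
    (hu : u ∈ Z) {x : R} (hlx : l.1 < x) (hxu : x < u.1) (hx : ∀ p ∈ Z, p.1 ≠ x) :
    ∃ p ∈ Z, ∃ q ∈ Z, p.1 < x ∧ x < q.1 ∧ p.2 < q.2 ∧ ∀ x' y', p.1 < x' → x' < q.1 →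
      p.2 < y' → y' < q.2 → SamePosition Z x' y' := by
  obtain ⟨p, ⟨hp, hpx⟩, hpmax⟩ := Set.exists_max_image {p ∈ Z | p.1 < x} Prod.fst
    (hZ.finite.subset (Set.sep_subset _ _)) ⟨l, hl, hlx⟩
  obtain ⟨q, ⟨hq, hxq⟩, hqmin⟩ := Set.exists_min_image {q ∈ Z | x < q.1} Prod.fst
    (hZ.finite.subset (Set.sep_subset _ _)) ⟨u, hu, hxu⟩
  refine ⟨p, hp, q, hq, hpx, hxq, ((hZ.samePosition p hp q hq).1).1 (hpx.trans hxq),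
    fun x' y' h1 h2 h3 h4 r hr ↦ ?_⟩
  rcases lt_or_gt_of_ne (hx r hr) with h | h
  · have h5 := hpmax r ⟨hr, h⟩
    have h6 : r.2 ≤ p.2 := not_lt.1 fun h' ↦ h5.not_gt ((hZ.samePosition p hp r hr).1.2 h')
    exact ⟨iff_of_false (h5.trans_lt h1).not_gt (h6.trans_lt h3).not_gt,
      iff_of_true (h5.trans_lt h1) (h6.trans_lt h3)⟩
  · have h5 := hqmin r ⟨hr, h⟩
    have h6 : q.2 ≤ r.2 := not_lt.1 fun h' ↦ h5.not_gt ((hZ.samePosition q hq r hr).2.2 h')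
    exact ⟨iff_of_true (h2.trans_le h5) (h4.trans_le h6),
      iff_of_false (h2.trans_le h5).not_gt (h4.trans_le h6).not_gt⟩

end SamePosition

section SignAgree

variable {R S : Type*} [Field R] [LinearOrder R] [Field S] [LinearOrder S]

theorem sign_leadingCoeff_congr {f : R[X]} {g : S[X]}
    (h : ∀ n, sign (f.coeff n) = sign (g.coeff n)) :
    sign f.leadingCoeff = sign g.leadingCoeff := by
  have h0 (n) : f.coeff n = 0 ↔ g.coeff n = 0 := by rw [← sign_eq_zero_iff, h, sign_eq_zero_iff]
  have : f.natDegree = g.natDegree := le_antisymm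
    (natDegree_le_iff_coeff_eq_zero.2 fun n hn ↦ (h0 n).2 (coeff_eq_zero_of_natDegree_lt hn))
    (natDegree_le_iff_coeff_eq_zero.2 fun n hn ↦ (h0 n).1 (coeff_eq_zero_of_natDegree_lt hn))
  rw [leadingCoeff, h, this, leadingCoeff]

/-- `f` and `g` have the same sign at points in the same position relative to `Z`. -/
def SignAgree (Z : Set (R × S)) (f : R[X]) (g : S[X]) : Prop :=
  ∀ x y, SamePosition Z x y → sign (f.eval x) = sign (g.eval y)

theorem SignAgree.mono {Z Z' : Set (R × S)} (h : Z ⊆ Z') {f : R[X]} {g : S[X]}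
    (hfg : SignAgree Z f g) : SignAgree Z' f g := fun x y hxy ↦ hfg x y (hxy.anti h)

end SignAgree

section Matching

variable {R S : Type*} [Field R] [LinearOrder R] [IsStrictOrderedRing R]
  [Field S] [LinearOrder S] [IsStrictOrderedRing S]

theorem ne_zero_on_Ioo_of_sign_const {f : R[X]} (hf : f ≠ 0) {a b : R} (hab : a < b) {t : SignType}
    (h : ∀ x, a < x → x < b → sign (f.eval x) = t) : t ≠ 0 := by
  rintro rfl
  refine hf (eq_zero_of_infinite_isRoot f ((Set.Ioo_infinite hab).mono fun x hx ↦ ?_))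
  exact sign_eq_zero_iff.1 (h x hx.1 hx.2)

/-- Sign agreement of `f` on `(a, b)` with `g` on `(a', b')`, possibly after splitting both
intervals at a zero. -/
def IntervalMatch (f : R[X]) (g : S[X]) (a b : R) (a' b' : S) : Prop :=
  (∀ x y, a < x → x < b → a' < y → y < b' → sign (f.eval x) = sign (g.eval y)) ∨
  ∃ ξ η, a < ξ ∧ ξ < b ∧ a' < η ∧ η < b' ∧ f.eval ξ = 0 ∧ g.eval η = 0 ∧
    (∀ x y, a < x → x < ξ → a' < y → y < η → sign (f.eval x) = sign (g.eval y)) ∧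
    (∀ x y, ξ < x → x < b → η < y → y < b' → sign (f.eval x) = sign (g.eval y))

theorem intervalMatch_of_derivative_pos (hR : IVP R) (hS : IVP S) {f : R[X]} {g : S[X]}
    {a b : R} {a' b' : S} (hab : a < b) (hab' : a' < b')
    (ha : sign (f.eval a) = sign (g.eval a')) (hb : sign (f.eval b) = sign (g.eval b'))
    (hf : ∀ x, a < x → x < b → 0 < f.derivative.eval x)
    (hg : ∀ y, a' < y → y < b' → 0 < g.derivative.eval y) : IntervalMatch f g a b a' b' := by
  by_cases h : f.eval a < 0 ∧ 0 < f.eval b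
  · have h1 : g.eval a' < 0 := by rw [← sign_eq_neg_one_iff, ← ha, sign_neg h.1]
    have h2 : 0 < g.eval b' := by rw [← sign_eq_one_iff, ← hb, sign_pos h.2]
    obtain ⟨ξ, hξ1, hξ2, hξ⟩ := hR f a b hab h.1 h.2
    obtain ⟨η, hη1, hη2, hη⟩ := hS g a' b' hab' h1 h2
    refine .inr ⟨ξ, η, hξ1, hξ2, hη1, hη2, hξ, hη, fun x y hx hxξ hy hyη ↦ ?_,
      fun x y hx hxξ hy hyη ↦ ?_⟩
    · rw [sign_neg (hξ ▸ hR.eval_lt_eval hf hx.le hxξ hξ2.le),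
        sign_neg (hη ▸ hS.eval_lt_eval hg hy.le hyη hη2.le)]
    · rw [sign_pos (hξ ▸ hR.eval_lt_eval hf hξ1.le hx hxξ.le),
        sign_pos (hη ▸ hS.eval_lt_eval hg hη1.le hy hyη.le)]
  · left
    intro x y hx1 hx2 hy1 hy2
    rw [not_and_or, not_lt, not_lt] at h
    rcases h with h | h
    · have h' : 0 ≤ g.eval a' := by rw [← sign_nonneg_iff, ← ha]; exact sign_nonneg_iff.2 h
      rw [sign_pos (h.trans_lt (hR.eval_lt_eval hf le_rfl hx1 hx2.le)),
        sign_pos (h'.trans_lt (hS.eval_lt_eval hg le_rfl hy1 hy2.le))]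
    · have h' : g.eval b' ≤ 0 := by rw [← sign_nonpos_iff, ← hb]; exact sign_nonpos_iff.2 h
      rw [sign_neg ((hR.eval_lt_eval hf hx1.le hx2 le_rfl).trans_le h),
        sign_neg ((hS.eval_lt_eval hg hy1.le hy2 le_rfl).trans_le h')]

theorem intervalMatch_neg_iff {f : R[X]} {g : S[X]} {a b : R} {a' b' : S} :
    IntervalMatch (-f) (-g) a b a' b' ↔ IntervalMatch f g a b a' b' := by
  simp [IntervalMatch, Left.sign_neg]

theorem intervalMatch_of_derivative (hR : IVP R) (hS : IVP S) {f : R[X]} {g : S[X]}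
    {a b : R} {a' b' : S} (hab : a < b) (hab' : a' < b')
    (ha : sign (f.eval a) = sign (g.eval a')) (hb : sign (f.eval b) = sign (g.eval b'))
    (hf : f.derivative ≠ 0)
    (hd : ∀ x y, a < x → x < b → a' < y → y < b' →
      sign (f.derivative.eval x) = sign (g.derivative.eval y)) :
    IntervalMatch f g a b a' b' := by
  obtain ⟨x₀, hx₀, hx₀'⟩ := exists_between hab
  obtain ⟨y₀, hy₀, hy₀'⟩ := exists_between hab'
  have h1 (x) (h : a < x) (h' : x < b) := hd x y₀ h h' hy₀ hy₀'
  have h2 (y) (h : a' < y) (h' : y < b') :=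
    (hd x₀ y hx₀ hx₀' h h').symm.trans (h1 x₀ hx₀ hx₀')
  have h3 := ne_zero_on_Ioo_of_sign_const hf hab h1
  generalize sign (g.derivative.eval y₀) = t at h1 h2 h3
  cases t with
  | zero => exact absurd rfl h3
  | pos =>
    exact intervalMatch_of_derivative_pos hR hS hab hab' ha hb
      (fun x h h' ↦ sign_eq_one_iff.1 (h1 x h h')) (fun x h h' ↦ sign_eq_one_iff.1 (h2 x h h'))
  | neg =>
    rw [← intervalMatch_neg_iff]
    exact intervalMatch_of_derivative_pos hR hS hab hab'
      (by simp [Left.sign_neg, ha]) (by simp [Left.sign_neg, hb])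
      (fun x h h' ↦ by simpa using sign_eq_neg_one_iff.1 (h1 x h h'))
      (fun x h h' ↦ by simpa using sign_eq_neg_one_iff.1 (h2 x h h'))

theorem eq_of_eval_eq_of_sign_derivative (hR : IVP R) {f : R[X]} (hf : f.derivative ≠ 0)
    {a b : R} (hab : a < b) {t : SignType}
    (hd : ∀ x, a < x → x < b → sign (f.derivative.eval x) = t) {x y : R} (hx : a < x) (hx' : x < b)
    (hy : a < y) (hy' : y < b) (h : f.eval x = f.eval y) : x = y := by
  have key {x y : R} (hx : a < x) (hy' : y < b) (h : f.eval x = f.eval y) : ¬ x < y := by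
    intro hxy
    obtain ⟨c, h1, h2, h3⟩ := hR.mean_value f hxy
    have h4 : f.derivative.eval c = 0 := by simpa [h, (sub_pos.2 hxy).ne'] using h3.symm
    refine ne_zero_on_Ioo_of_sign_const hf hab hd ?_
    rw [← hd c (hx.trans h1) (h2.trans hy'), h4, sign_zero]
  exact le_antisymm (not_lt.1 (key hy hx' h.symm)) (not_lt.1 (key hx hy' h))

theorem IsMatching.exists_signAgree (hR : IVP R) (hS : IVP S) {Z : Set (R × S)}
    (hZ : IsMatching Z) {l u : R × S} (hl : l ∈ Z) (hu : u ∈ Z) {f : R[X]} {g : S[X]}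
    (hlow : ∀ x y, x ≤ l.1 → y ≤ l.2 → sign (f.eval x) = sign (g.eval y))
    (hupp : ∀ x y, u.1 ≤ x → u.2 ≤ y → sign (f.eval x) = sign (g.eval y))
    (hpt : ∀ p ∈ Z, sign (f.eval p.1) = sign (g.eval p.2))
    (hf : f.derivative ≠ 0) (hg : g.derivative ≠ 0)
    (hd : SignAgree Z f.derivative g.derivative) :
    ∃ Z', Z ⊆ Z' ∧ IsMatching Z' ∧ SignAgree Z' f g ∧
      ∀ p ∈ Z', p ∈ Z ∨ f.eval p.1 = 0 ∧ g.eval p.2 = 0 := by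
  let N : Set (R × S) := {p | (f.eval p.1 = 0 ∧ g.eval p.2 = 0) ∧ SamePosition Z p.1 p.2 ∧
    l.1 < p.1 ∧ p.1 < u.1}
  refine ⟨Z ∪ N, Set.subset_union_left, ⟨?_, ?_⟩, ?_, ?_⟩
  · refine hZ.finite.union (((f.roots.toFinset ×ˢ g.roots.toFinset).finite_toSet).subset ?_)
    rintro p ⟨⟨h1, h2⟩, -⟩
    have hf0 : f ≠ 0 := by rintro rfl; simp at hf
    have hg0 : g ≠ 0 := by rintro rfl; simp at hg
    simp [hf0, hg0, h1, h2]
  · rintro p hp r hr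
    by_cases hpZ : p ∈ Z
    · rcases hr with hr | hr
      · exact hZ.samePosition p hpZ r hr
      · have := hr.2.1 p hpZ
        exact ⟨this.2, this.1⟩
    have hp := hp.resolve_left hpZ
    rcases hr with hr | hr
    · exact hp.2.1 r hr
    obtain ⟨⟨hfp, hgp⟩, hpc, hlp, hpu⟩ := hp
    obtain ⟨⟨hfr, hgr⟩, hrc, hlr, hru⟩ := hr
    obtain ⟨a, ha, b, hb, hap, hpb, hab', hgap⟩ := hZ.exists_gap hl hu hlp hpu fun q hq hqp ↦
      hpZ (by rwa [← Prod.ext hqp (hpc.eq_of_mem hq hqp)])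
    have hap' := (hpc a ha).2.1 hap
    have hpb' := (hpc b hb).1.1 hpb
    have hra := hrc a ha
    have hrb := hrc b hb
    rcases le_or_gt r.1 a.1 with h1 | h1
    · have h2 : r.2 ≤ a.2 := not_lt.1 fun h ↦ h1.not_gt (hra.2.2 h)
      exact ⟨iff_of_false (h1.trans_lt hap).not_gt (h2.trans_lt hap').not_gt,
        iff_of_true (h1.trans_lt hap) (h2.trans_lt hap')⟩
    rcases le_or_gt b.1 r.1 with h2 | h2
    · have h3 : b.2 ≤ r.2 := not_lt.1 fun h ↦ h2.not_gt (hrb.1.2 h)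
      exact ⟨iff_of_true (hpb.trans_le h2) (hpb'.trans_le h3),
        iff_of_false (hpb.trans_le h2).not_gt (hpb'.trans_le h3).not_gt⟩
    have e1 : r.1 = p.1 := eq_of_eval_eq_of_sign_derivative hR hf (hap.trans hpb)
      (fun x hx hx' ↦ hd x p.2 (hgap x p.2 hx hx' hap' hpb')) h1 h2 hap hpb (hfr.trans hfp.symm)
    have e2 : r.2 = p.2 := eq_of_eval_eq_of_sign_derivative hS hg hab'
      (fun y hy hy' ↦ (hd p.1 y (hgap p.1 y hap hpb hy hy')).symm) (hra.2.1 h1) (hrb.1.1 h2)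
      hap' hpb' (hgr.trans hgp.symm)
    simp [e1, e2]
  · intro x y hxy
    have hxyZ := hxy.anti Set.subset_union_left
    rcases le_or_gt x l.1 with h1 | h1
    · exact hlow x y h1 (not_lt.1 fun h ↦ h1.not_gt ((hxyZ l hl).2.2 h))
    rcases le_or_gt u.1 x with h2 | h2
    · exact hupp x y h2 (not_lt.1 fun h ↦ h2.not_gt ((hxyZ u hu).1.2 h))
    by_cases hx : ∃ p ∈ Z, p.1 = x
    · obtain ⟨p, hp, rfl⟩ := hx
      rw [← hxyZ.eq_of_mem hp rfl]
      exact hpt p hp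
    push Not at hx
    obtain ⟨a, ha, b, hb, hax, hxb, hab', hgap⟩ := hZ.exists_gap hl hu h1 h2 hx
    have hay := (hxyZ a ha).2.1 hax
    have hyb := (hxyZ b hb).1.1 hxb
    rcases intervalMatch_of_derivative hR hS (hax.trans hxb) hab' (hpt a ha) (hpt b hb) hf
      (fun x y h1 h2 h3 h4 ↦ hd x y (hgap x y h1 h2 h3 h4)) with
      h | ⟨ξ, η, h3, h4, h5, h6, hξ, hη, h7, h8⟩
    · exact h x y hax hxb hay hyb
    · have hl1 : l.1 < ξ := by
        by_contra! hle
        have h9 := (hgap ((a.1 + ξ) / 2) y (by linarith) (by linarith) hay hyb l hl).2.2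
          ((hxyZ l hl).2.1 h1)
        linarith
      have hu1 : ξ < u.1 := by
        by_contra! hle
        have h9 := (hgap ((b.1 + ξ) / 2) y (by linarith) (by linarith) hay hyb u hu).1.2
          ((hxyZ u hu).1.1 h2)
        linarith
      have hmem := hxy (ξ, η) (.inr ⟨⟨hξ, hη⟩, hgap ξ η h3 h4 h5 h6, hl1, hu1⟩)
      rcases lt_trichotomy x ξ with h | h | h
      · exact h7 x y hax h hay (hmem.1.1 h)
      · have : y = η := le_antisymm (not_lt.1 fun hh ↦ h.le.not_gt (hmem.2.2 hh))
          (not_lt.1 fun hh ↦ h.ge.not_gt (hmem.1.2 hh))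
        rw [h, this, hξ, hη, sign_zero, sign_zero]
      · exact h8 x y h hxb (hmem.2.1 h) hyb
  · rintro p (hp | hp)
    · exact .inl hp
    · exact .inr hp.1

end Matching

section ReductionClosed

variable {A : Type*} [CommRing A]

theorem exists_pseudo_div (h f : A[X]) (hh : h.natDegree ≠ 0) :
    ∃ r : A[X], r.natDegree < h.natDegree ∧
      ∃ (m : ℕ) (q : A[X]), C h.leadingCoeff ^ m * f = q * h + r := by
  induction hn : f.natDegree using Nat.strong_induction_on generalizing f with
  | _ n ih =>
  rcases lt_or_ge f.natDegree h.natDegree with hlt | hge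
  · exact ⟨f, hlt, 0, 0, by simp⟩
  let f' := C h.leadingCoeff * f - C f.leadingCoeff * X ^ (f.natDegree - h.natDegree) * h
  have hf' : f'.natDegree < n := by
    rw [← hn]
    refine lt_of_le_of_ne ((natDegree_sub_le_of_le (n := f.natDegree)
      (natDegree_C_mul_le _ _) ?_).trans_eq (max_self _)) fun heq ↦ ?_
    · rw [mul_assoc]
      refine (natDegree_C_mul_le _ _).trans (natDegree_mul_le.trans ?_)
      have := natDegree_X_pow_le (R := A) (f.natDegree - h.natDegree)
      omega
    · have h0 : f'.coeff f.natDegree = 0 := by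
        simp only [f', coeff_sub, coeff_C_mul, mul_assoc]
        rw [coeff_X_pow_mul', if_pos (by omega), Nat.sub_sub_self hge]
        rw [coeff_natDegree, coeff_natDegree, mul_comm, sub_self]
      have h1 : f' = 0 := by rwa [← heq, coeff_natDegree, leadingCoeff_eq_zero] at h0
      rw [h1, natDegree_zero] at heq
      omega
  obtain ⟨r, hr, m, q, hq⟩ := ih _ hf' f' rfl
  refine ⟨r, hr, m + 1, q + C h.leadingCoeff ^ m * (C f.leadingCoeff *
    X ^ (f.natDegree - h.natDegree)), ?_⟩
  linear_combination (exp := 1) hq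

/-- The reductions of `s` by `h`: deleting the leading term of `h`, differentiating `h`, and
pseudo-dividing the members of `s` by `h`. -/
def ContainsReductions (s : Finset A[X]) (h : A[X]) : Prop :=
  h.natDegree ≠ 0 → h.eraseLead ∈ s ∧ derivative h ∈ s ∧ ∀ f ∈ s, ∃ r ∈ s,
    r.natDegree < h.natDegree ∧ ∃ (m : ℕ) (q : A[X]), C h.leadingCoeff ^ m * f = q * h + r

theorem natDegree_eraseLead_lt {h : A[X]} (hh : h.natDegree ≠ 0) :
    h.eraseLead.natDegree < h.natDegree := by
  have := eraseLead_natDegree_le h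
  omega

theorem exists_reductionClosed (F : Finset A[X]) :
    ∃ s, F ⊆ s ∧ ∀ h ∈ s, ContainsReductions s h := by
  classical
  suffices H : ∀ j : ℕ, ∃ s, F ⊆ s ∧ (∀ h ∈ s, h.natDegree ≤ F.sup natDegree) ∧
      ∀ h ∈ s, F.sup natDegree < h.natDegree + j → ContainsReductions s h by
    obtain ⟨s, hs, -, h⟩ := H (F.sup natDegree + 1)
    exact ⟨s, hs, fun f hf ↦ h f hf (by omega)⟩
  intro j
  induction j with
  | zero =>
    refine ⟨F, subset_rfl, fun h hh ↦ Finset.le_sup hh, fun h hh hlt ↦ ?_⟩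
    exact absurd (Finset.le_sup (f := natDegree) hh) (by omega)
  | succ j ih =>
    obtain ⟨s, hFs, hdeg, hs⟩ := ih
    let t := s.filter fun h ↦ F.sup natDegree = h.natDegree + j ∧ h.natDegree ≠ 0
    choose! rem hrem using fun h : A[X] ↦ fun f : A[X] ↦ exists_pseudo_div h f
    let N := t.image eraseLead ∪ t.image (fun h ↦ derivative h) ∪
      (t ×ˢ s).image fun p ↦ rem p.1 p.2
    have ht {h} : h ∈ t ↔ h ∈ s ∧ F.sup natDegree = h.natDegree + j ∧ h.natDegree ≠ 0 := by
      simp [t]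
    have hN : ∀ h ∈ N, h.natDegree + j < F.sup natDegree := by
      intro h hh
      simp only [N, Finset.mem_union, Finset.mem_image, Finset.mem_product] at hh
      obtain (⟨g, hg, rfl⟩ | ⟨g, hg, rfl⟩) | ⟨⟨g, f⟩, ⟨hg, hf⟩, rfl⟩ := hh
      · have := natDegree_eraseLead_lt (ht.1 hg).2.2
        have := (ht.1 hg).2.1
        omega
      · have := natDegree_derivative_lt (ht.1 hg).2.2
        have := (ht.1 hg).2.1
        omega
      · have := (hrem g f (ht.1 hg).2.2).1
        have := (ht.1 hg).2.1
        dsimp only at *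
        omega
    refine ⟨s ∪ N, hFs.trans Finset.subset_union_left, fun h hh ↦ ?_, fun h hh hlt hpos ↦ ?_⟩
    · rcases Finset.mem_union.1 hh with hh | hh
      · exact hdeg h hh
      · have := hN h hh
        omega
    · have hhs : h ∈ s := by
        refine (Finset.mem_union.1 hh).resolve_right fun h' ↦ ?_
        have := hN h h'
        omega
      have hnew : ∀ f ∈ N, ∃ r ∈ s ∪ N, r.natDegree < h.natDegree ∧
          ∃ (m : ℕ) (q : A[X]), C h.leadingCoeff ^ m * f = q * h + r := fun f hf ↦
        ⟨f, Finset.mem_union_right _ hf, by have := hN f hf; omega, 0, 0, by simp⟩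
      by_cases hj : F.sup natDegree < h.natDegree + j
      · obtain ⟨h1, h2, h3⟩ := hs h hhs hj hpos
        refine ⟨Finset.mem_union_left _ h1, Finset.mem_union_left _ h2, fun f hf ↦ ?_⟩
        rcases Finset.mem_union.1 hf with hf | hf
        · obtain ⟨r, hr, h4⟩ := h3 f hf
          exact ⟨r, Finset.mem_union_left _ hr, h4⟩
        · exact hnew f hf
      · have hht : h ∈ t := ht.2 ⟨hhs, by omega, hpos⟩
        refine ⟨Finset.mem_union_right _ ?_, Finset.mem_union_right _ ?_, fun f hf ↦ ?_⟩
        · simp only [N, Finset.mem_union, Finset.mem_image]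
          exact .inl (.inl ⟨h, hht, rfl⟩)
        · simp only [N, Finset.mem_union, Finset.mem_image]
          exact .inl (.inr ⟨h, hht, rfl⟩)
        · rcases Finset.mem_union.1 hf with hf | hf
          · refine ⟨rem h f, Finset.mem_union_right _ ?_, hrem h f hpos⟩
            simp only [N, Finset.mem_union, Finset.mem_image, Finset.mem_product]
            exact .inr ⟨(h, f), ⟨hht, hf⟩, rfl⟩
          · exact hnew f hf

end ReductionClosed

theorem map_eraseLead_of_leadingCoeff {A R : Type*} [CommRing A] [CommRing R] {α : A →+* R}
    (f : A[X]) (h : α f.leadingCoeff = 0) : (f.eraseLead).map α = f.map α := by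
  have := congrArg (map α) (eraseLead_add_monomial_natDegree_leadingCoeff f)
  rwa [Polynomial.map_add, map_monomial, h, monomial_zero_right, add_zero] at this

section Transfer

variable {A R S : Type*} [CommRing A] [Field R] [LinearOrder R] [IsStrictOrderedRing R]
  [Field S] [LinearOrder S] [IsStrictOrderedRing S] {α : A →+* R} {β : A →+* S}

theorem _root_.SignType.eq_of_mul_eq_mul {t u v : SignType} (ht : t ≠ 0) (h : t * u = t * v) :
    u = v := by
  revert t u v; decide

theorem exists_matching (hR : IVP R) (hS : IVP S) (l u : R × S) (hlu : l.1 < u.1)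
    (hlu' : l.2 < u.2) (s : Finset A[X]) (hs : ∀ h ∈ s, ContainsReductions s h)
    (hcoeff : ∀ f ∈ s, ∀ n, sign (α (f.coeff n)) = sign (β (f.coeff n)))
    (hlow : ∀ f ∈ s, ∀ x y, x ≤ l.1 → y ≤ l.2 →
      sign ((f.map α).eval x) = sign ((f.map β).eval y))
    (hupp : ∀ f ∈ s, ∀ x y, u.1 ≤ x → u.2 ≤ y →
      sign ((f.map α).eval x) = sign ((f.map β).eval y)) :
    ∃ Z, IsMatching Z ∧ l ∈ Z ∧ u ∈ Z ∧ (∀ f ∈ s, SignAgree Z (f.map α) (f.map β)) ∧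
      ∀ p ∈ Z, p = l ∨ p = u ∨ ∃ h ∈ s, h.natDegree ≠ 0 ∧ α h.leadingCoeff ≠ 0 ∧
        (h.map α).eval p.1 = 0 ∧ (h.map β).eval p.2 = 0 := by
  classical
  induction s using Finset.induction_on_max_value (natDegree (R := A)) with
  | empty =>
    refine ⟨{l, u}, ⟨by simp, ?_⟩, by simp, by simp, by simp, by simp⟩
    simp [SamePosition, hlu, hlu', hlu.not_gt, hlu'.not_gt]
  | insert a s ha hmax ih =>
    have hlower {r : A[X]} (hr : r ∈ insert a s) {h : A[X]} (hh : h ∈ insert a s)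
        (hlt : r.natDegree < h.natDegree) : r ∈ s := by
      refine (Finset.mem_insert.1 hr).resolve_left ?_
      rintro rfl
      rcases Finset.mem_insert.1 hh with rfl | hh
      · exact lt_irrefl _ hlt
      · exact (hmax h hh).not_gt hlt
    obtain ⟨Z, hZ, hl, hu, hagree, hroot⟩ := ih
      (fun h hh hpos ↦ by
        have hh' := Finset.mem_insert_of_mem (a := h) (b := a) hh
        obtain ⟨h1, h2, h3⟩ := hs h hh' hpos
        refine ⟨hlower h1 hh' (natDegree_eraseLead_lt hpos),
          hlower h2 hh' (natDegree_derivative_lt hpos), fun f hf ↦ ?_⟩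
        obtain ⟨r, hr, hrh, h4⟩ := h3 f (Finset.mem_insert_of_mem hf)
        exact ⟨r, hlower hr hh' hrh, hrh, h4⟩)
      (fun f hf ↦ hcoeff f (Finset.mem_insert_of_mem hf))
      (fun f hf ↦ hlow f (Finset.mem_insert_of_mem hf))
      (fun f hf ↦ hupp f (Finset.mem_insert_of_mem hf))
    have haI : a ∈ insert a s := Finset.mem_insert_self a s
    have hroot' : ∀ p ∈ Z, p = l ∨ p = u ∨ ∃ h ∈ insert a s, h.natDegree ≠ 0 ∧
        α h.leadingCoeff ≠ 0 ∧ (h.map α).eval p.1 = 0 ∧ (h.map β).eval p.2 = 0 := by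
      intro p hp
      obtain h | h | ⟨h, hh, h'⟩ := hroot p hp
      · exact .inl h
      · exact .inr (.inl h)
      · exact .inr (.inr ⟨h, Finset.mem_insert_of_mem hh, h'⟩)
    have hzero : ∀ f ∈ insert a s, α f.leadingCoeff = 0 ↔ β f.leadingCoeff = 0 := by
      intro f hf
      rw [← sign_eq_zero_iff, leadingCoeff, hcoeff f hf, sign_eq_zero_iff]
    by_cases hdeg : a.natDegree = 0
    · refine ⟨Z, hZ, hl, hu, ?_, hroot'⟩
      rw [Finset.forall_mem_insert]
      refine ⟨fun x y _ ↦ ?_, hagree⟩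
      rw [natDegree_eq_zero] at hdeg
      obtain ⟨c, rfl⟩ := hdeg
      simpa using hcoeff (C c) haI 0
    obtain ⟨hera, hder, hrem⟩ := hs a haI hdeg
    by_cases hlc : α a.leadingCoeff = 0
    · refine ⟨Z, hZ, hl, hu, ?_, hroot'⟩
      rw [Finset.forall_mem_insert]
      refine ⟨?_, hagree⟩
      rw [← map_eraseLead_of_leadingCoeff a hlc,
        ← map_eraseLead_of_leadingCoeff a ((hzero a haI).1 hlc)]
      exact hagree _ (hlower hera haI (natDegree_eraseLead_lt hdeg))
    have hlc' := mt (hzero a haI).2 hlc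
    have hdα : (a.map α).derivative ≠ 0 := fun h ↦ hdeg <| by
      rw [← natDegree_map_of_leadingCoeff_ne_zero α hlc]
      exact derivative_eq_zero.1 h
    have hdβ : (a.map β).derivative ≠ 0 := fun h ↦ hdeg <| by
      rw [← natDegree_map_of_leadingCoeff_ne_zero β hlc']
      exact derivative_eq_zero.1 h
    have hpt : ∀ p ∈ Z, sign ((a.map α).eval p.1) = sign ((a.map β).eval p.2) := by
      intro p hp
      obtain rfl | rfl | ⟨h, hh, hh0, hhlc, hα, hβ⟩ := hroot p hp
      · exact hlow a haI _ _ le_rfl le_rfl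
      · exact hupp a haI _ _ le_rfl le_rfl
      have hh' := Finset.mem_insert_of_mem (b := a) hh
      obtain ⟨r, hr, hrh, m, q, hq⟩ := (hs h hh' hh0).2.2 a haI
      have hsr := hagree r (hlower hr hh' hrh) _ _ (hZ.samePosition p hp)
      have e1 : α h.leadingCoeff ^ m * (a.map α).eval p.1 = (r.map α).eval p.1 := by
        simpa [hα] using congrArg (fun g ↦ (g.map α).eval p.1) hq
      have e2 : β h.leadingCoeff ^ m * (a.map β).eval p.2 = (r.map β).eval p.2 := by
        simpa [hβ] using congrArg (fun g ↦ (g.map β).eval p.2) hq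
      refine SignType.eq_of_mul_eq_mul (t := sign (α h.leadingCoeff ^ m)) ?_ ?_
      · exact sign_ne_zero.2 (pow_ne_zero _ hhlc)
      · rw [← sign_mul, e1, hsr, ← e2, sign_mul, sign_pow, sign_pow, leadingCoeff, hcoeff h hh']
    obtain ⟨Z', hZZ', hZ', hag, hnew⟩ := hZ.exists_signAgree hR hS hl hu (hlow a haI) (hupp a haI)
      hpt hdα hdβ (by
        rw [derivative_map, derivative_map]
        exact hagree _ (hlower hder haI (natDegree_derivative_lt hdeg)))
    refine ⟨Z', hZ', hZZ' hl, hZZ' hu, ?_, fun p hp ↦ ?_⟩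
    · rw [Finset.forall_mem_insert]
      exact ⟨hag, fun f hf ↦ (hagree f hf).mono hZZ'⟩
    · rcases hnew p hp with hp | ⟨h1, h2⟩
      · exact hroot' p hp
      · exact .inr (.inr ⟨a, haI, hdeg, hlc, h1, h2⟩)

theorem eventually_sign_eval_map (s : Finset A[X]) (γ : A →+* R) : ∀ᶠ M in atTop, ∀ f ∈ s,
    (∀ x, M ≤ x → sign ((f.map γ).eval x) = sign (f.map γ).leadingCoeff) ∧
    ∀ x, x ≤ -M → sign ((f.map γ).eval x) = sign ((f.map γ).comp (C (-1) * X)).leadingCoeff := by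
  rw [eventually_all_finset]
  intro f _
  filter_upwards [eventually_forall_ge_atTop.2 (eventually_sign_eval (f.map γ)),
    eventually_forall_ge_atTop.2 (eventually_sign_eval ((f.map γ).comp (C (-1) * X)))] with M h1 h2
  refine ⟨h1, fun x hx ↦ ?_⟩
  simpa using h2 (-x) (le_neg_of_le_neg hx)

theorem exists_sign_eval_eq (hR : IVP R) (hS : IVP S) (s : Finset A[X])
    (hs : ∀ h ∈ s, ContainsReductions s h)
    (hcoeff : ∀ f ∈ s, ∀ n, sign (α (f.coeff n)) = sign (β (f.coeff n))) (x : R) :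
    ∃ y, ∀ f ∈ s, sign ((f.map α).eval x) = sign ((f.map β).eval y) := by
  obtain ⟨M, hM, hM0, hMx⟩ := ((eventually_sign_eval_map s α).and
    ((eventually_gt_atTop 0).and (eventually_gt_atTop |x|))).exists
  obtain ⟨M', hM', hM'0⟩ := ((eventually_sign_eval_map s β).and (eventually_gt_atTop 0)).exists
  obtain ⟨h1, h2⟩ := abs_lt.1 hMx
  obtain ⟨Z, hZ, hl, hu, hagree, -⟩ := exists_matching (α := α) (β := β) hR hS (-M, -M') (M, M')
    (h1.trans h2) (by dsimp only; linarith) s hs hcoeff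
    (fun f hf x y hx hy ↦ by
      rw [(hM f hf).2 x hx, (hM' f hf).2 y hy]
      exact sign_leadingCoeff_congr fun n ↦ by
        have h (k : ℕ) : sign ((-1 : R) ^ k) = sign ((-1 : S) ^ k) := by
          rw [sign_pow, sign_pow, sign_neg (neg_lt_zero.2 one_pos),
            sign_neg (neg_lt_zero.2 one_pos)]
        rw [comp_C_mul_X_coeff, comp_C_mul_X_coeff, coeff_map, coeff_map, sign_mul, sign_mul,
          hcoeff f hf, h])
    (fun f hf x y hx hy ↦ by
      rw [(hM f hf).1 x hx, (hM' f hf).1 y hy]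
      exact sign_leadingCoeff_congr fun n ↦ by simp [hcoeff f hf])
  by_cases hx : ∃ p ∈ Z, p.1 = x
  · obtain ⟨p, hp, rfl⟩ := hx
    exact ⟨p.2, fun f hf ↦ hagree f hf _ _ (hZ.samePosition p hp)⟩
  · push Not at hx
    obtain ⟨p, hp, q, hq, hpx, hxq, hpq, hgap⟩ := hZ.exists_gap hl hu h1 h2 hx
    obtain ⟨y, hy, hy'⟩ := exists_between hpq
    exact ⟨y, fun f hf ↦ hagree f hf _ _ (hgap x y hpx hxq hy hy')⟩

/-- Sign conditions on finitely many univariate polynomials transfer between fields with the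
intermediate value property, provided finitely many coefficient expressions have equal signs. -/
theorem exists_finset_transfer (F : Finset A[X]) : ∃ G : Finset A,
    ∀ {R S : Type} [Field R] [LinearOrder R] [IsStrictOrderedRing R]
      [Field S] [LinearOrder S] [IsStrictOrderedRing S] (α : A →+* R) (β : A →+* S),
      IVP R → IVP S → (∀ g ∈ G, sign (α g) = sign (β g)) →
      ∀ x, ∃ y, ∀ f ∈ F, sign ((f.map α).eval x) = sign ((f.map β).eval y) := by
  classical
  obtain ⟨s, hFs, hs⟩ := exists_reductionClosed F
  refine ⟨s.biUnion fun f ↦ insert 0 f.coeffs, fun {R S} _ _ _ _ _ _ α β hR hS hG x ↦ ?_⟩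
  obtain ⟨y, hy⟩ := exists_sign_eval_eq (α := α) (β := β) hR hS s hs (fun f hf n ↦ by
    refine hG _ (Finset.mem_biUnion.2 ⟨f, hf, ?_⟩)
    by_cases h : f.coeff n = 0
    · simp [h]
    · exact Finset.mem_insert_of_mem (coeff_mem_coeffs h)) x
  exact ⟨y, fun f hf ↦ hy f (hFs hf)⟩

end Transfer

end Polynomial

namespace MvPolynomial

open SignType

theorem eval₂_eq_eval_map_finSuccEquiv {R S : Type*} [CommRing R] [CommRing S] (ψ : R →+* S)
    {n : ℕ} (a : Fin (n + 1) → S) (f : MvPolynomial (Fin (n + 1)) R) :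
    eval₂Hom ψ a f = ((finSuccEquiv R n f).map (eval₂Hom ψ (Fin.tail a))).eval (a 0) := by
  suffices eval₂Hom ψ a = ((Polynomial.evalRingHom (a 0)).comp
      (Polynomial.mapRingHom (eval₂Hom ψ (Fin.tail a)))).comp
        (finSuccEquiv R n : MvPolynomial (Fin (n + 1)) R →+* _) from DFunLike.congr_fun this f
  refine ringHom_ext (fun c ↦ ?_) fun i ↦ ?_
  · simp [finSuccEquiv_apply]
  · refine Fin.cases ?_ (fun j ↦ ?_) i
    · simp [finSuccEquiv_X_zero]
    · simp [finSuccEquiv_X_succ, Fin.tail]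

theorem exists_sign_eval_eq {S : Type} [Field S] [LinearOrder S] [IsStrictOrderedRing S]
    (hS : Polynomial.IVP S) (ψ : ℝ →+* S) (n : ℕ) (F : Finset (MvPolynomial (Fin n) ℝ))
    (a : Fin n → S) :
    ∃ b : Fin n → ℝ, ∀ f ∈ F, sign (eval₂Hom ψ a f) = sign (eval b f) := by
  classical
  induction n with
  | zero =>
    refine ⟨Fin.elim0, fun f _ ↦ ?_⟩
    have hψ : StrictMono ψ := by
      refine Monotone.strictMono_of_injective (fun x y hxy ↦ ?_) ψ.injective
      have : ψ (y - x) = ψ (√(y - x)) ^ 2 := by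
        rw [← map_pow, Real.sq_sqrt (sub_nonneg.2 hxy)]
      have h2 : 0 ≤ ψ (y - x) := this ▸ sq_nonneg _
      simpa using h2
    obtain ⟨c, rfl⟩ := C_surjective (Fin 0) f
    rcases lt_trichotomy c 0 with h | rfl | h
    · simp [sign_neg h, sign_neg (by simpa using hψ h : ψ c < 0)]
    · simp
    · simp [sign_pos h, sign_pos (by simpa using hψ h : 0 < ψ c)]
  | succ n ih =>
    obtain ⟨G, hG⟩ := Polynomial.exists_finset_transfer (F.image (finSuccEquiv ℝ n))
    obtain ⟨b, hb⟩ := ih G (Fin.tail a)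
    obtain ⟨y, hy⟩ := hG (eval₂Hom ψ (Fin.tail a)) (eval b) hS Polynomial.ivp_real hb (a 0)
    refine ⟨Fin.cons y b, fun f hf ↦ ?_⟩
    have := hy _ (Finset.mem_image_of_mem _ hf)
    rwa [← eval_eq_eval_mv_eval', ← eval₂_eq_eval_map_finSuccEquiv] at this

end MvPolynomial

theorem IsSumSq.map {R S : Type*} [NonAssocSemiring R] [NonAssocSemiring S] (f : R →+* S) {x : R}
    (hx : IsSumSq x) : IsSumSq (f x) := by
  induction hx with
  | zero => rw [map_zero]; exact .zero
  | sq_add a _ ih => rw [map_add, map_mul]; exact .sq_add _ ih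

theorem IsSumSq.exists_map_eq {R S : Type*} [NonAssocSemiring R] [NonAssocSemiring S]
    {f : R →+* S} (hf : Function.Surjective f) {y : S} (hy : IsSumSq y) :
    ∃ x, IsSumSq x ∧ f x = y := by
  induction hy with
  | zero => exact ⟨0, .zero, map_zero f⟩
  | sq_add b _ ih =>
    obtain ⟨x, hx, rfl⟩ := ih
    obtain ⟨a, rfl⟩ := hf b
    exact ⟨a * a + x, .sq_add a hx, by simp⟩

theorem IsSumSq.sq {R : Type*} [CommSemiring R] (a : R) : IsSumSq (a ^ 2) := by
  rw [pow_two]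
  exact .mul_self a

section RealIdeal

variable {A : Type*} [CommRing A]

/-- A ring in which `-1` is not a sum of squares has a real prime ideal. -/
theorem exists_isPrime_real (h : ¬ IsSumSq (-1 : A)) : ∃ p : Ideal A, p.IsPrime ∧
    ∀ a s : A, IsSumSq s → a ^ 2 + s ∈ p → a ∈ p := by
  obtain ⟨p, -, hp⟩ := zorn_le_nonempty₀ {I : Ideal A | ∀ s, IsSumSq s → 1 + s ∉ I}
    (fun c hc hchain J hJ ↦ ⟨sSup c, fun s hs hmem ↦ by
      obtain ⟨I, hI, hI'⟩ := (Submodule.mem_sSup_of_directed ⟨J, hJ⟩ hchain.directedOn).1 hmem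
      exact hc hI s hs hI', fun I hI ↦ le_sSup hI⟩)
    ⊥ (fun s hs h0 ↦ h <| by
      rw [Ideal.mem_bot] at h0
      rwa [← eq_neg_of_add_eq_zero_right h0])
  have key {a : A} (ha : a ∉ p) : ∃ t b, IsSumSq t ∧ 1 + t - a * b ∈ p := by
    by_contra! hcon
    refine ha (hp.le_of_ge (y := p ⊔ Ideal.span {a}) (fun t ht hmem ↦ ?_) le_sup_left
      (Ideal.mem_sup_right (Ideal.mem_span_singleton_self a)))
    obtain ⟨y, hy, z, hz, hyz⟩ := Submodule.mem_sup.1 hmem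
    obtain ⟨b, rfl⟩ := Ideal.mem_span_singleton'.1 hz
    refine hcon t b ht ?_
    rwa [← hyz, mul_comm a b, add_sub_cancel_right]
  refine ⟨p, ⟨fun htop ↦ ?_, fun {a b} hab ↦ ?_⟩, fun a s hs has ↦ ?_⟩
  · exact hp.prop 0 .zero (htop ▸ Submodule.mem_top)
  · by_contra! hcon
    obtain ⟨s, c, hs, hc⟩ := key hcon.1
    obtain ⟨t, d, ht, hd⟩ := key hcon.2
    refine hp.prop (s + t + s * t) ((hs.add ht).add (hs.mul ht)) ?_
    have : 1 + (s + t + s * t) =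
        (1 + t) * (1 + s - a * c) + a * c * (1 + t - b * d) + c * d * (a * b) := by ring
    rw [this]
    exact add_mem (add_mem (p.mul_mem_left _ hc) (p.mul_mem_left _ hd)) (p.mul_mem_left _ hab)
  · by_contra ha
    obtain ⟨t, b, ht, hb⟩ := key ha
    refine hp.prop (t + t + t ^ 2 + s * b ^ 2)
      (((ht.add ht).add (.sq t)).add (hs.mul (.sq b))) ?_
    have : 1 + (t + t + t ^ 2 + s * b ^ 2) =
        (1 + t + a * b) * (1 + t - a * b) + b ^ 2 * (a ^ 2 + s) := by ring
    rw [this]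
    exact add_mem (p.mul_mem_left _ hb) (p.mul_mem_left _ has)

theorem IsSumSq.exists_algebraMap_eq_mul_sq (M : Submonoid A) {L : Type*} [CommRing L]
    [Algebra A L] [IsLocalization M L] {x : L} (hx : IsSumSq x) :
    ∃ s : A, ∃ d ∈ M, IsSumSq s ∧ algebraMap A L s = x * algebraMap A L d ^ 2 := by
  induction hx with
  | zero => exact ⟨0, 1, M.one_mem, .zero, by simp⟩
  | sq_add y _ ih =>
    obtain ⟨s, d, hd, hs, h⟩ := ih
    obtain ⟨⟨a, b⟩, hab⟩ := IsLocalization.surj M y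
    refine ⟨a * d * (a * d) + s * (b : A) ^ 2, d * b, M.mul_mem hd b.2,
      .sq_add _ (hs.mul (.sq _)), ?_⟩
    simp only [map_add, map_mul, map_pow, h, ← hab]
    ring

theorem exists_ringHom_field_not_isSumSq {A : Type} [CommRing A] (h : ¬ IsSumSq (-1 : A)) :
    ∃ (K : Type) (_ : Field K), Nonempty (A →+* K) ∧ ¬ IsSumSq (-1 : K) := by
  obtain ⟨p, hp, hreal⟩ := exists_isPrime_real h
  refine ⟨FractionRing (A ⧸ p), inferInstance,
    ⟨(algebraMap (A ⧸ p) _).comp (Ideal.Quotient.mk p)⟩, fun hK ↦ ?_⟩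
  obtain ⟨s, d, hd, hs, hsd⟩ := hK.exists_algebraMap_eq_mul_sq (nonZeroDivisors (A ⧸ p))
  obtain ⟨s, hs', rfl⟩ := hs.exists_map_eq Ideal.Quotient.mk_surjective
  obtain ⟨d, rfl⟩ := Ideal.Quotient.mk_surjective d
  rw [← map_pow, neg_one_mul, ← map_neg, (IsFractionRing.injective _ _).eq_iff,
    eq_neg_iff_add_eq_zero, ← map_pow, ← map_add, Ideal.Quotient.eq_zero_iff_mem, add_comm] at hsd
  exact nonZeroDivisors.ne_zero hd (Ideal.Quotient.eq_zero_iff_mem.2 (hreal d s hs' hsd))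

end RealIdeal

namespace Polynomial

/-- A field in which `-1` is not a sum of squares, and which loses this property in every proper
finite simple extension. -/
structure IsMaximalReal (S : Type*) [Field S] : Prop where
  not_isSumSq : ¬ IsSumSq (-1 : S)
  isSumSq_adjoinRoot : ∀ f : S[X], Irreducible f → f.natDegree ≠ 1 →
    IsSumSq (-1 : AdjoinRoot f)

theorem exists_subfield_isMaximalReal {Ω : Type*} [Field Ω] [IsAlgClosed Ω] (K : Subfield Ω)
    (hK : ¬ IsSumSq (-1 : K)) : ∃ S : Subfield Ω, K ≤ S ∧ IsMaximalReal S := by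
  obtain ⟨S, hKS, hS⟩ := zorn_le_nonempty₀ {L : Subfield Ω | ¬ IsSumSq (-1 : L)}
    (fun c hc hchain L hL ↦ ⟨sSup c, fun hs ↦ by
      have key (x : ↥(sSup c)) (hx : IsSumSq x) : ∃ L ∈ c, ∃ y : L, IsSumSq y ∧ (y : Ω) = x := by
        induction hx with
        | zero => exact ⟨L, hL, 0, .zero, rfl⟩
        | sq_add a _ ih =>
          obtain ⟨L₁, hL₁, y, hy, hyx⟩ := ih
          obtain ⟨L₂, hL₂, ha⟩ :=
            (Subfield.mem_sSup_of_directedOn ⟨L, hL⟩ hchain.directedOn).1 a.2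
          obtain ⟨L₃, hL₃, h₁, h₂⟩ := hchain.directedOn _ hL₁ _ hL₂
          exact ⟨L₃, hL₃, _, .sq_add ⟨a, h₂ ha⟩ (hy.map (Subfield.inclusion h₁)),
            congrArg ((a : Ω) * a + ·) hyx⟩
      obtain ⟨L, hL, y, hy, hy1⟩ := key _ hs
      have : y = -1 := Subtype.ext hy1
      exact hc hL (this ▸ hy), fun L hL ↦ le_sSup hL⟩) K hK
  refine ⟨S, hKS, hS.prop, fun f hf hdeg ↦ ?_⟩
  have := Fact.mk hf
  obtain ⟨β, hβ⟩ := IsAlgClosed.exists_eval₂_eq_zero S.subtype f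
    (fun h ↦ hf.not_isUnit (isUnit_iff_degree_eq_zero.2 h))
  let g := AdjoinRoot.lift S.subtype β hβ
  have hSg : S ≤ g.fieldRange := fun x hx ↦ ⟨AdjoinRoot.of f ⟨x, hx⟩, AdjoinRoot.lift_of hβ⟩
  have hβS : β ∉ S := fun h ↦ hdeg <| natDegree_eq_of_degree_eq_some <|
    degree_eq_one_of_irreducible_of_root hf (x := ⟨β, h⟩) <| by
      apply S.subtype.injective
      rw [map_zero, ← hβ, ← eval₂_at_apply]
      rfl
  have hβg : β ∈ g.fieldRange := ⟨AdjoinRoot.root f, AdjoinRoot.lift_root hβ⟩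
  have hsum : IsSumSq (-1 : g.fieldRange) := by
    by_contra hcon
    exact hβS (hS.le_of_ge hcon hSg hβg)
  obtain ⟨x, hx, hx1⟩ := hsum.exists_map_eq g.rangeRestrictField_bijective.surjective
  have : x = -1 := g.rangeRestrictField_bijective.injective (by rw [hx1, map_neg, map_one])
  exact this ▸ hx

namespace IsMaximalReal

variable {S : Type*} [Field S]

theorem exists_one_add_eq_mul (hS : IsMaximalReal S) {f : S[X]} (hf : Irreducible f)
    (hdeg : f.natDegree ≠ 1) : ∃ g h, IsSumSq g ∧ 1 + g = f * h ∧
      g.natDegree ≤ 2 * (f.natDegree - 1) ∧ IsSumSq (g.coeff (2 * (f.natDegree - 1))) := by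
  have key (x : AdjoinRoot f) (hx : IsSumSq x) : ∃ g, IsSumSq g ∧ AdjoinRoot.mk f g = x ∧
      g.natDegree ≤ 2 * (f.natDegree - 1) ∧ IsSumSq (g.coeff (2 * (f.natDegree - 1))) := by
    induction hx with
    | zero => exact ⟨0, .zero, map_zero _, by simp, by simp⟩
    | sq_add a _ ih =>
      obtain ⟨g, hg, rfl, hg1, hg2⟩ := ih
      obtain ⟨a, rfl⟩ := AdjoinRoot.mk_surjective a
      have hlt : (a % f).natDegree ≤ f.natDegree - 1 :=
        Nat.le_sub_one_of_lt (natDegree_mod_lt a hf.natDegree_pos.ne')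
      refine ⟨a % f * (a % f) + g, .sq_add _ hg, ?_, ?_, ?_⟩
      · have : AdjoinRoot.mk f (a % f) = AdjoinRoot.mk f a := by
          rw [AdjoinRoot.mk_eq_mk, ← dvd_neg, neg_sub]
          exact ⟨a / f, by rw [sub_eq_iff_eq_add']; exact (EuclideanDomain.mod_add_div a f).symm⟩
        simp [this]
      · refine (natDegree_add_le_of_degree_le ?_ hg1)
        rw [two_mul]
        exact natDegree_mul_le_of_le hlt hlt
      · rw [coeff_add, two_mul, coeff_mul_add_eq_of_natDegree_le hlt hlt, ← two_mul]
        exact .sq_add _ hg2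
  obtain ⟨g, hg, h1, h2, h3⟩ := key _ (hS.isSumSq_adjoinRoot f hf hdeg)
  obtain ⟨h, hh⟩ : f ∣ 1 + g := by
    rw [← AdjoinRoot.mk_eq_zero, map_add, map_one, h1, add_neg_cancel]
  exact ⟨g, h, hg, hh, h2, h3⟩

theorem isSumSq_neg_of_not_isSquare (hS : IsMaximalReal S) {a : S} (ha : ¬ IsSquare a) :
    IsSumSq (-a) := by
  have hirr : Irreducible (X ^ 2 - C a) := X_pow_sub_C_irreducible_of_prime Nat.prime_two
    fun b hb ↦ ha ⟨b, by rw [← hb, pow_two]⟩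
  have hdeg : (X ^ 2 - C a).natDegree = 2 := natDegree_X_pow_sub_C
  obtain ⟨g, h, hg, hgh, hg1, hg2⟩ := hS.exists_one_add_eq_mul hirr (by rw [hdeg]; decide)
  rw [hdeg] at hg1 hg2
  have h0 : h ≠ 0 := by
    rintro rfl
    have := hg.map (evalRingHom 0)
    rw [mul_zero] at hgh
    rw [eq_neg_of_add_eq_zero_right hgh] at this
    exact hS.not_isSumSq (by simpa using this)
  have hh : h.natDegree = 0 := by
    have : (1 + g).natDegree ≤ 2 := natDegree_add_le_of_degree_le (by simp) hg1
    rw [hgh, natDegree_mul hirr.ne_zero h0, hdeg] at this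
    omega
  obtain ⟨c, rfl⟩ := natDegree_eq_zero.1 hh
  have hc : c ≠ 0 := by rintro rfl; simp at h0
  have h1 := congrArg (eval 0) hgh
  have h2 := congrArg (coeff · 2) hgh
  simp [coeff_one] at h1 h2
  have h3 : -a = (1 + g.eval 0) * c * c⁻¹ ^ 2 := by
    rw [h1]
    field_simp
  rw [h3]
  exact ((IsSumSq.one.add (hg.map (evalRingHom 0))).mul (h2 ▸ hg2)).mul (.sq _)

theorem isSumSq_or_isSumSq_neg (hS : IsMaximalReal S) (a : S) : IsSumSq a ∨ IsSumSq (-a) := by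
  by_cases h : IsSquare a
  · exact .inl h.isSumSq
  · exact .inr (hS.isSumSq_neg_of_not_isSquare h)

theorem exists_linearOrder (hS : IsMaximalReal S) :
    ∃ _ : LinearOrder S, IsStrictOrderedRing S := by
  classical
  let P : RingCone S :=
    { Subsemiring.sumSq S with
      eq_zero_of_mem_of_neg_mem' := fun {a} h1 h2 ↦ by
        by_contra h0
        refine hS.not_isSumSq ?_
        have : (-1 : S) = -a * a * a⁻¹ ^ 2 := by field_simp
        rw [this]
        exact (IsSumSq.mul (by simpa using h2) (by simpa using h1)).mul (.sq _) }
  have : HasMemOrNegMem P := ⟨fun a ↦ by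
    have := hS.isSumSq_or_isSumSq_neg a
    simpa [P] using this⟩
  let _ : LinearOrder S := .mkOfAddGroupCone P
  have : IsOrderedRing S := .mkOfCone P
  exact ⟨inferInstance, inferInstance⟩

theorem exists_root_of_mul_neg (hS : IsMaximalReal S) [LinearOrder S] [IsStrictOrderedRing S]
    (n : ℕ) (f : S[X]) (hn : f.natDegree = n) {a b : S} (hab : a < b)
    (h : f.eval a * f.eval b < 0) : ∃ c, a < c ∧ c < b ∧ f.eval c = 0 := by
  induction n using Nat.strong_induction_on generalizing f with
  | _ n ih =>
  have hf0 : f ≠ 0 := by rintro rfl; simp at h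
  by_cases hf : Irreducible f
  · by_cases hdeg : f.natDegree = 1
    · obtain ⟨u, hu, v, rfl⟩ := natDegree_eq_one.1 hdeg
      simp only [eval_add, eval_mul, eval_C, eval_X] at h ⊢
      have hsq : 0 < u ^ 2 := by positivity
      have hr : u * (-v / u) = -v := by field_simp
      have h' : (a - -v / u) * (b - -v / u) < 0 := by
        refine neg_of_mul_neg_left (b := u ^ 2) ?_ hsq.le
        calc _ = (u * a - u * (-v / u)) * (u * b - u * (-v / u)) := by ring
          _ < 0 := by rw [hr]; simpa using h
      refine ⟨-v / u, ?_, ?_, by rw [hr, neg_add_cancel]⟩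
      · rcases mul_neg_iff.1 h' with h' | h' <;> linarith
      · rcases mul_neg_iff.1 h' with h' | h' <;> linarith
    · obtain ⟨g, k, hg, hgk, hg1, -⟩ := hS.exists_one_add_eq_mul hf hdeg
      have hpos (x : S) : 0 < f.eval x * k.eval x := by
        rw [← eval_mul, ← hgk, eval_add, eval_one]
        exact add_pos_of_pos_of_nonneg one_pos (hg.map (evalRingHom x)).nonneg
      have hk0 : k ≠ 0 := by rintro rfl; simpa using hpos 0
      have hk : k.natDegree < n := by
        have : (1 + g).natDegree ≤ 2 * (f.natDegree - 1) :=
          natDegree_add_le_of_degree_le (by simp) hg1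
        rw [hgk, natDegree_mul hf0 hk0] at this
        have := hf.natDegree_pos
        omega
      obtain ⟨c, -, -, hc⟩ := ih _ hk k rfl (by
        refine neg_of_mul_pos_right (a := f.eval a * f.eval b) ?_ h.le
        calc _ < (f.eval a * k.eval a) * (f.eval b * k.eval b) := mul_pos (hpos a) (hpos b)
          _ = _ := by ring)
      exact absurd (hpos c) (by simp [hc])
  · have hu : ¬ IsUnit f := fun hu ↦ by
      obtain ⟨c, -, rfl⟩ := isUnit_iff.1 hu
      simp only [eval_C] at h
      exact h.not_ge (mul_self_nonneg c)
    rw [irreducible_iff] at hf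
    push Not at hf
    obtain ⟨u, v, rfl, hu', hv'⟩ := hf hu
    have hu0 := left_ne_zero_of_mul hf0
    have hv0 := right_ne_zero_of_mul hf0
    rw [natDegree_mul hu0 hv0] at hn
    have h1 := natDegree_pos_iff_degree_pos.2 (degree_pos_of_ne_zero_of_nonunit hu0 hu')
    have h2 := natDegree_pos_iff_degree_pos.2 (degree_pos_of_ne_zero_of_nonunit hv0 hv')
    simp only [eval_mul] at h ⊢
    rw [mul_mul_mul_comm] at h
    rcases mul_neg_iff.1 h with ⟨-, h⟩ | ⟨h, -⟩
    · obtain ⟨c, hac, hcb, hc⟩ := ih _ (by omega) v rfl h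
      exact ⟨c, hac, hcb, by simp [hc]⟩
    · obtain ⟨c, hac, hcb, hc⟩ := ih _ (by omega) u rfl h
      exact ⟨c, hac, hcb, by simp [hc]⟩

end IsMaximalReal

theorem exists_ringHom_IVP {A : Type} [CommRing A] (h : ¬ IsSumSq (-1 : A)) :
    ∃ (S : Type) (_ : Field S) (_ : LinearOrder S), IsStrictOrderedRing S ∧ IVP S ∧
      Nonempty (A →+* S) := by
  obtain ⟨K, _, ⟨f⟩, hK⟩ := exists_ringHom_field_not_isSumSq h
  let g := algebraMap K (AlgebraicClosure K)
  obtain ⟨S, hKS, hS⟩ := exists_subfield_isMaximalReal g.fieldRange fun h1 ↦ by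
    obtain ⟨x, hx, hx1⟩ := h1.exists_map_eq g.rangeRestrictField_bijective.surjective
    have : x = -1 := g.rangeRestrictField_bijective.injective (by rw [hx1, map_neg, map_one])
    exact hK (this ▸ hx)
  obtain ⟨_, _⟩ := hS.exists_linearOrder
  exact ⟨S, inferInstance, inferInstance, inferInstance,
    fun p a b hab ha hb ↦ hS.exists_root_of_mul_neg _ p rfl hab (mul_neg_of_neg_of_pos ha hb),
    ⟨(Subfield.inclusion hKS).comp (g.rangeRestrictField.comp f)⟩⟩

end Polynomial

/-- The weak real Nullstellensatz. -/
theorem Algebra.FiniteType.isSumSq_neg_one_of_isEmpty {A : Type} [CommRing A] [Algebra ℝ A]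
    [Algebra.FiniteType ℝ A] (h : IsEmpty (A →ₐ[ℝ] ℝ)) : IsSumSq (-1 : A) := by
  by_contra hA
  obtain ⟨S, _, _, _, hS, ⟨g⟩⟩ := Polynomial.exists_ringHom_IVP hA
  obtain ⟨n, f, hf⟩ := Algebra.FiniteType.iff_quotient_mvPolynomial''.1 ‹Algebra.FiniteType ℝ A›
  obtain ⟨G, hG⟩ := IsNoetherian.noetherian (RingHom.ker f.toRingHom)
  obtain ⟨b, hb⟩ := exists_sign_eval_eq hS (g.comp (algebraMap ℝ A)) n G fun i ↦ g (f (X i))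
  have hgf : eval₂Hom (g.comp (algebraMap ℝ A)) (fun i ↦ g (f (X i))) = g.comp f.toRingHom := by
    refine ringHom_ext (fun c ↦ ?_) fun i ↦ by simp
    simp [← algebraMap_eq]
  refine h.false (AlgHom.liftOfSurjective f hf (aeval b) ?_)
  rw [← hG, Submodule.span_le]
  intro p hp
  have h0 : f.toRingHom p = 0 := by
    rw [← RingHom.mem_ker, ← hG]
    exact Submodule.subset_span hp
  have := hb p hp
  rw [hgf, RingHom.comp_apply, h0, map_zero, sign_zero, eq_comm, sign_eq_zero_iff] at this
  simpa [coe_aeval_eq_eval] using this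

theorem IsSumSq.exists_re_eq {B : Type*} [CommRing B] {q : B} {x : QuadraticAlgebra B q 0}
    (hx : IsSumSq x) : ∃ s₀ s₁, IsSumSq s₀ ∧ IsSumSq s₁ ∧ x.re = s₀ + q * s₁ := by
  induction hx with
  | zero => exact ⟨0, 0, .zero, .zero, by simp⟩
  | sq_add a _ ih =>
    obtain ⟨s₀, s₁, h₀, h₁, h⟩ := ih
    refine ⟨_, _, .sq_add a.re h₀, .sq_add a.im h₁, ?_⟩
    simp only [QuadraticAlgebra.re_add, QuadraticAlgebra.re_mul, h]
    ring

namespace MvPolynomial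

theorem eval_algHom_quotient {σ : Type*} {I : Ideal (MvPolynomial σ ℝ)}
    (g : (MvPolynomial σ ℝ ⧸ I) →ₐ[ℝ] ℝ) (p : MvPolynomial σ ℝ) :
    eval (fun i ↦ g (Ideal.Quotient.mk I (X i))) p = g (Ideal.Quotient.mk I p) := by
  have : aeval (fun i ↦ g (Ideal.Quotient.mk I (X i))) = g.comp (Ideal.Quotient.mkₐ ℝ I) :=
    algHom_ext fun i ↦ by simp
  simpa [coe_aeval_eq_eval] using DFunLike.congr_fun this p

variable {σ : Type} [Finite σ] (I : Ideal (MvPolynomial σ ℝ))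

/-- Stengle's Positivstellensatz for one inequality without solutions. -/
theorem exists_one_add_mem_of_forall_eval_neg (q : MvPolynomial σ ℝ)
    (h : ∀ z : σ → ℝ, (∀ p ∈ I, eval z p = 0) → eval z q < 0) :
    ∃ s₀ s₁, IsSumSq s₀ ∧ IsSumSq s₁ ∧ 1 + s₀ + q * s₁ ∈ I := by
  let A := QuadraticAlgebra (MvPolynomial σ ℝ ⧸ I) (Ideal.Quotient.mk I q) 0
  have : Algebra.FiniteType ℝ A :=
    .trans (S := MvPolynomial σ ℝ ⧸ I) inferInstance inferInstance
  have hempty : IsEmpty (A →ₐ[ℝ] ℝ) := by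
    refine ⟨fun g ↦ ?_⟩
    let g' := g.comp (IsScalarTower.toAlgHom ℝ (MvPolynomial σ ℝ ⧸ I) A)
    refine (h (fun i ↦ g' (Ideal.Quotient.mk I (X i))) fun p hp ↦ ?_).not_ge ?_
    · rw [eval_algHom_quotient, Ideal.Quotient.eq_zero_iff_mem.2 hp, map_zero]
    · have hω : algebraMap _ A (Ideal.Quotient.mk I q) =
          QuadraticAlgebra.omega * QuadraticAlgebra.omega := by
        refine QuadraticAlgebra.ext ?_ ?_ <;> simp [A]
      rw [eval_algHom_quotient]
      change 0 ≤ g (algebraMap _ A (Ideal.Quotient.mk I q))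
      rw [hω, map_mul]
      exact mul_self_nonneg _
  obtain ⟨t₀, t₁, h₀, h₁, ht⟩ :=
    (Algebra.FiniteType.isSumSq_neg_one_of_isEmpty hempty).exists_re_eq
  obtain ⟨s₀, h₀', rfl⟩ := h₀.exists_map_eq Ideal.Quotient.mk_surjective
  obtain ⟨s₁, h₁', rfl⟩ := h₁.exists_map_eq Ideal.Quotient.mk_surjective
  refine ⟨s₀, s₁, h₀', h₁', ?_⟩
  rw [← Ideal.Quotient.eq_zero_iff_mem, map_add, map_add, map_mul, map_one, add_assoc, ← ht]
  exact add_neg_cancel 1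

/-- The real Nullstellensatz. -/
theorem exists_pow_add_mem_of_forall_eval_eq_zero (f : MvPolynomial σ ℝ)
    (h : ∀ z : σ → ℝ, (∀ p ∈ I, eval z p = 0) → eval z f = 0) :
    ∃ (m : ℕ) (s : _), IsSumSq s ∧ f ^ (2 * m) + s ∈ I := by
  let L := Localization.Away (Ideal.Quotient.mk I f)
  have hempty : IsEmpty (L →ₐ[ℝ] ℝ) := by
    refine ⟨fun g ↦ ?_⟩
    let g' := g.comp (IsScalarTower.toAlgHom ℝ (MvPolynomial σ ℝ ⧸ I) L)
    have h0 := h (fun i ↦ g' (Ideal.Quotient.mk I (X i))) fun p hp ↦ by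
      rw [eval_algHom_quotient, Ideal.Quotient.eq_zero_iff_mem.2 hp, map_zero]
    rw [eval_algHom_quotient] at h0
    exact ((IsLocalization.Away.algebraMap_isUnit (S := L) (Ideal.Quotient.mk I f)).map g).ne_zero
      h0
  obtain ⟨t, d, hd, ht, htd⟩ := (Algebra.FiniteType.isSumSq_neg_one_of_isEmpty
    hempty).exists_algebraMap_eq_mul_sq (.powers (Ideal.Quotient.mk I f))
  obtain ⟨s, hs, rfl⟩ := ht.exists_map_eq Ideal.Quotient.mk_surjective
  obtain ⟨k, rfl⟩ := hd
  rw [neg_one_mul, ← map_pow, ← map_neg,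
    IsLocalization.eq_iff_exists (.powers (Ideal.Quotient.mk I f))] at htd
  obtain ⟨⟨_, l, rfl⟩, hl⟩ := htd
  refine ⟨l + k, s * (f ^ l) ^ 2, hs.mul (.sq _), ?_⟩
  rw [← Ideal.Quotient.eq_zero_iff_mem]
  simp only [map_add, map_mul, map_pow] at hl ⊢
  linear_combination Ideal.Quotient.mk I f ^ l * hl

theorem totalDegree_C_mul_le {σ R : Type*} [CommSemiring R] (c : R) (p : MvPolynomial σ R) :
    (C c * p).totalDegree ≤ p.totalDegree :=
  (totalDegree_mul _ _).trans (by simp)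

end MvPolynomial

section SOS

variable {σ : Type}

theorem IsSumSq.isSOS {p : MvPolynomial σ ℝ} (hp : IsSumSq p) : IsSOS p := by
  induction hp with
  | zero => exact ⟨0, 0, by simp⟩
  | sq_add a _ ih =>
    obtain ⟨t, s, rfl⟩ := ih
    exact ⟨t + 1, Fin.cons a s, by simp [Fin.sum_univ_succ, pow_two]⟩

theorem IsSOS.eval_nonneg {p : MvPolynomial σ ℝ} (hp : IsSOS p) (z : σ → ℝ) : 0 ≤ eval z p := by
  obtain ⟨t, s, rfl⟩ := hp
  rw [map_sum]
  exact Finset.sum_nonneg fun i _ ↦ by rw [map_pow]; exact sq_nonneg _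

theorem isSumSq_C {c : ℝ} (hc : 0 ≤ c) : IsSumSq (C c : MvPolynomial σ ℝ) := by
  rw [← Real.sq_sqrt hc, C_pow]
  exact .sq _

theorem isSumSq_C_add_mul_add_sq {δ : ℝ} (hδ : 0 < δ) (a : ℝ) (t : MvPolynomial σ ℝ) :
    IsSumSq (C δ + C a * t + C (a ^ 2 / (4 * δ)) * t ^ 2) := by
  have h1 : √δ ≠ 0 := (Real.sqrt_pos.2 hδ).ne'
  have h2 : δ = √δ ^ 2 := (Real.sq_sqrt hδ.le).symm
  have h3 : C δ + C a * t + C (a ^ 2 / (4 * δ)) * t ^ 2 = (C √δ + C (a / (2 * √δ)) * t) ^ 2 := by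
    have h4 : a = 2 * (√δ * (a / (2 * √δ))) := by field_simp
    have h5 : a ^ 2 / (4 * δ) = (a / (2 * √δ)) ^ 2 := by
      rw [div_pow, mul_pow, ← h2]
      norm_num
    have h6 : (C a : MvPolynomial σ ℝ) = 2 * (C √δ * C (a / (2 * √δ))) := by
      rw [← C_mul, ← map_ofNat C 2, ← C_mul, ← h4]
    have h7 : (C δ : MvPolynomial σ ℝ) = C √δ ^ 2 := by rw [← C_pow, ← h2]
    rw [h5, C_pow, h6, h7]
    ring
  rw [h3]
  exact .sq _

theorem exists_isSumSq_C_add_add_mul_pow (h : MvPolynomial σ ℝ) (k : ℕ) :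
    ∀ δ : ℝ, 0 < δ → ∃ c : ℝ, 0 ≤ c ∧ IsSumSq (C δ + h + C c * h ^ 2 ^ (k + 1)) := by
  induction k with
  | zero =>
    intro δ hδ
    exact ⟨1 ^ 2 / (4 * δ), by positivity, by simpa using isSumSq_C_add_mul_add_sq hδ 1 h⟩
  | succ k ih =>
    intro δ hδ
    obtain ⟨c, -, hc⟩ := ih (δ / 2) (half_pos hδ)
    refine ⟨(-c) ^ 2 / (4 * (δ / 2)), by positivity, ?_⟩
    have h1 : (C δ : MvPolynomial σ ℝ) = C (δ / 2) + C (δ / 2) := by rw [← C_add, add_halves]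
    have h2 := hc.add (isSumSq_C_add_mul_add_sq (half_pos hδ) (-c) (h ^ 2 ^ (k + 1)))
    rw [C_neg, ← pow_mul, ← pow_succ] at h2
    rw [h1]
    exact (congrArg IsSumSq (by ring)).mp h2

end SOS

section Assembly

variable {σ : Type} {ι : Type*} {φ : ι → MvPolynomial σ ℝ} {q F : MvPolynomial σ ℝ} {fstar : ℝ}

theorem eval_eq_zero_of_mem_span_range {z : σ → ℝ} (hz : ∀ i, eval z (φ i) = 0)
    {p : MvPolynomial σ ℝ} (hp : p ∈ Ideal.span (Set.range φ)) : eval z p = 0 := by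
  have : Ideal.span (Set.range φ) ≤ RingHom.ker (eval z) := by
    rw [Ideal.span_le]
    rintro _ ⟨i, rfl⟩
    exact hz i
  exact this hp

theorem exists_isSumSq_of_fiber [Finite σ]
    (hmin : ∀ z, (∀ i, eval z (φ i) = 0) → 0 ≤ eval z q → fstar ≤ eval z F) (v : ℝ) :
    ∃ c₀ c₁, IsSumSq c₀ ∧ IsSumSq c₁ ∧ ∀ z, (∀ i, eval z (φ i) = 0) → eval z F = v →
      v - fstar = eval z (c₀ + q * c₁) := by
  rcases le_or_gt fstar v with hv | hv
  · exact ⟨C (v - fstar), 0, isSumSq_C (sub_nonneg.2 hv), .zero, by simp⟩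
  obtain ⟨s₀, s₁, h₀, h₁, hs⟩ := exists_one_add_mem_of_forall_eval_neg
    (Ideal.span (Set.range φ) ⊔ Ideal.span {F - C v}) q fun z hz ↦ by
      by_contra! hq
      have h1 := hmin z (fun i ↦ hz _ (Ideal.mem_sup_left (Ideal.subset_span ⟨i, rfl⟩))) hq
      have h2 := hz _ (Ideal.mem_sup_right (Ideal.mem_span_singleton_self _))
      rw [map_sub, eval_C] at h2
      linarith
  have hC : IsSumSq (C (fstar - v) : MvPolynomial σ ℝ) := isSumSq_C (sub_nonneg.2 hv.le)
  refine ⟨C (fstar - v) * s₀, C (fstar - v) * s₁, hC.mul h₀, hC.mul h₁, fun z hz hzF ↦ ?_⟩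
  obtain ⟨a, ha, b, hb, hab⟩ := Submodule.mem_sup.1 hs
  obtain ⟨b, rfl⟩ := Ideal.mem_span_singleton'.1 hb
  have h1 := congrArg (eval z) hab
  simp only [map_add, map_mul, map_sub, map_one, eval_C, hzF,
    eval_eq_zero_of_mem_span_range hz ha] at h1 ⊢
  linear_combination (fstar - v) * h1

theorem exists_isSumSq_of_finite [Finite σ]
    (hfin : {v : ℝ | ∃ z : σ → ℝ, (∀ i, eval z (φ i) = 0) ∧ eval z F = v}.Finite)
    (hmin : ∀ z, (∀ i, eval z (φ i) = 0) → 0 ≤ eval z q → fstar ≤ eval z F) :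
    ∃ c₀ c₁, IsSumSq c₀ ∧ IsSumSq c₁ ∧ ∀ z, (∀ i, eval z (φ i) = 0) →
      eval z F - fstar = eval z (c₀ + q * c₁) := by
  choose c₀ c₁ h₀ h₁ hc using exists_isSumSq_of_fiber hmin
  let W := hfin.toFinset
  let l (v : ℝ) : MvPolynomial σ ℝ := Polynomial.aeval F (Lagrange.basis W id v)
  have hl (v : ℝ) (z : σ → ℝ) : eval z (l v) = (Lagrange.basis W id v).eval (eval z F) := by
    rw [← coe_aeval_eq_eval, RingHom.coe_coe, ← Polynomial.aeval_algHom_apply]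
    simp
  refine ⟨∑ v ∈ W, c₀ v * l v ^ 2, ∑ v ∈ W, c₁ v * l v ^ 2, .sum fun v _ ↦ (h₀ v).mul (.sq _),
    .sum fun v _ ↦ (h₁ v).mul (.sq _), fun z hz ↦ ?_⟩
  have hW : eval z F ∈ W := hfin.mem_toFinset.2 ⟨z, hz, rfl⟩
  rw [Finset.mul_sum, ← Finset.sum_add_distrib, map_sum, Finset.sum_eq_single_of_mem _ hW]
  · have h1 : eval z (l (eval z F)) = 1 := by
      rw [hl]
      exact Lagrange.eval_basis_self (v := id) Function.injective_id.injOn hW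
    rw [hc _ z hz rfl]
    simp [h1]
  · intro v _ hv
    have h0 : eval z (l v) = 0 := by
      rw [hl]
      exact Lagrange.eval_basis_of_ne (v := id) hv hW
    simp [h0]

theorem exists_pow_two_pow_add_eq_sum [Finite σ] [Fintype ι] {h : MvPolynomial σ ℝ}
    (hh : ∀ z, (∀ i, eval z (φ i) = 0) → eval z h = 0) :
    ∃ (m : ℕ) (s : MvPolynomial σ ℝ) (p : ι → MvPolynomial σ ℝ), IsSumSq s ∧
      h ^ 2 ^ (m + 1) + s = ∑ i, φ i * p i := by
  obtain ⟨m, s, hs, hmem⟩ := exists_pow_add_mem_of_forall_eval_eq_zero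
    (Ideal.span (Set.range φ)) h fun z hz ↦ hh z fun i ↦ hz _ (Ideal.subset_span ⟨i, rfl⟩)
  obtain ⟨p, hp⟩ := Ideal.mem_span_range_iff_exists_fun.1
    (Ideal.mul_mem_left _ ((h ^ (2 ^ m - m)) ^ 2) hmem)
  refine ⟨m, (h ^ (2 ^ m - m)) ^ 2 * s, p, (IsSumSq.sq _).mul hs, ?_⟩
  have hpow : h ^ 2 ^ (m + 1) = (h ^ (2 ^ m - m)) ^ 2 * h ^ (2 * m) := by
    rw [← pow_mul, ← pow_add]
    congr 1
    have := m.lt_two_pow_self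
    omega
  rw [hpow, ← mul_add, ← hp]
  exact Finset.sum_congr rfl fun i _ ↦ mul_comm _ _

theorem exists_forall_inIQ1Trunc [Finite σ] [Fintype ι]
    (hfin : {v : ℝ | ∃ z : σ → ℝ, (∀ i, eval z (φ i) = 0) ∧ eval z F = v}.Finite)
    (hmin : ∀ z, (∀ i, eval z (φ i) = 0) → 0 ≤ eval z q → fstar ≤ eval z F) :
    ∃ k : ℕ, ∀ ε : ℝ, 0 < ε → InIQ1Trunc k φ q (F - C (fstar - ε)) := by
  obtain ⟨c₀, c₁, h₀, h₁, hc⟩ := exists_isSumSq_of_finite hfin hmin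
  set h := F - C fstar - (c₀ + q * c₁) with hh
  obtain ⟨m, s, p, hs, hp⟩ := exists_pow_two_pow_add_eq_sum (h := h) (φ := φ) fun z hz ↦ by
    rw [hh, map_sub, map_sub, eval_C, hc z hz, sub_self]
  let n := 2 ^ (m + 1)
  refine ⟨n * h.totalDegree + s.totalDegree + c₀.totalDegree + (q * c₁).totalDegree +
    ∑ i, (φ i * p i).totalDegree, fun ε hε ↦ ?_⟩
  obtain ⟨c, hc0, hsq⟩ := exists_isSumSq_C_add_add_mul_pow h m ε hε
  refine ⟨fun i ↦ C (-c) * p i, C ε + h + C c * h ^ n + C c * s + c₀, c₁,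
    ((hsq.add ((isSumSq_C hc0).mul hs)).add h₀).isSOS, h₁.isSOS, fun i ↦ ?_, ?_, by omega, ?_⟩
  · have h2 := Finset.single_le_sum (f := fun i ↦ (φ i * p i).totalDegree)
      (fun _ _ ↦ Nat.zero_le _) (Finset.mem_univ i)
    have h3 := totalDegree_C_mul_le (-c) (φ i * p i)
    rw [mul_left_comm]
    omega
  · have h2 : h.totalDegree ≤ n * h.totalDegree := Nat.le_mul_of_pos_left _ (by positivity)
    have h3 := (totalDegree_C_mul_le c (h ^ n)).trans (totalDegree_pow h n)
    have h4 := totalDegree_C_mul_le c s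
    have h5 := totalDegree_add (C ε + h + C c * h ^ n + C c * s) c₀
    have h6 := totalDegree_add (C ε + h + C c * h ^ n) (C c * s)
    have h7 := totalDegree_add (C ε + h) (C c * h ^ n)
    have h8 := totalDegree_add (C ε) h
    rw [totalDegree_C] at h8
    omega
  · have h2 : ∑ i, φ i * (C (-c) * p i) = -C c * (h ^ n + s) := by
      rw [hp, Finset.mul_sum, C_neg]
      exact Finset.sum_congr rfl fun i _ ↦ by ring
    rw [h2, C_sub]
    linear_combination -hh

theorem InIQ1Trunc.mono [Fintype ι] {k l : ℕ} (hkl : k ≤ l) {f : MvPolynomial σ ℝ}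
    (h : InIQ1Trunc k φ q f) : InIQ1Trunc l φ q f := by
  obtain ⟨p, s₀, s₁, h₀, h₁, hp, hs₀, hs₁, rfl⟩ := h
  exact ⟨p, s₀, s₁, h₀, h₁, fun i ↦ (hp i).trans (by omega), by omega, by omega, rfl⟩

theorem InIQ1Trunc.eval_nonneg [Fintype ι] {k : ℕ} {f : MvPolynomial σ ℝ}
    (h : InIQ1Trunc k φ q f) {z : σ → ℝ} (hz : ∀ i, eval z (φ i) = 0) (hq : 0 ≤ eval z q) :
    0 ≤ eval z f := by
  obtain ⟨p, s₀, s₁, h₀, h₁, -, -, -, rfl⟩ := h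
  simp only [map_add, map_sum, map_mul, hz, zero_mul, Finset.sum_const_zero, zero_add]
  exact add_nonneg (h₀.eval_nonneg z) (mul_nonneg hq (h₁.eval_nonneg z))

end Assembly

/-- If `F` attains only finitely many values on `{φ = 0}`, the set
`K₂ = {φ = 0, q ≥ 0}` is nonempty and `f*` is the minimum of `F` on `K₂`, then there is
`k₂` such that `F − (f* − ε) ∈ Ideal(φ)_{2k₂} + Qmod(q)_{2k₂}` for every `ε > 0`;
consequently the SOS bound `f_k = sup{γ : F − γ ∈ Ideal(φ)_{2k} + Qmod(q)_{2k}}` equals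
`f*` for all `k ≥ k₂`. -/
theorem stmt9 (N r : ℕ) (φ : Fin r → MvPolynomial (Fin N) ℝ)
    (q F : MvPolynomial (Fin N) ℝ) (fstar : ℝ)
    (hfin : {v : ℝ | ∃ z : Fin N → ℝ, (∀ i, eval z (φ i) = 0) ∧ eval z F = v}.Finite)
    (hmin : IsLeast
      {v : ℝ | ∃ z : Fin N → ℝ, ((∀ i, eval z (φ i) = 0) ∧ 0 ≤ eval z q) ∧ eval z F = v}
      fstar) :
    ∃ k2 : ℕ, (∀ ε : ℝ, 0 < ε → InIQ1Trunc k2 φ q (F - C (fstar - ε))) ∧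
      ∀ k ≥ k2, sSup {γ : ℝ | InIQ1Trunc k φ q (F - C γ)} = fstar := by
  obtain ⟨⟨z, ⟨hz, hzq⟩, hzF⟩, hlow⟩ := hmin
  obtain ⟨k, hk⟩ := exists_forall_inIQ1Trunc hfin fun z hz hq ↦ hlow ⟨z, ⟨hz, hq⟩, rfl⟩
  refine ⟨k, hk, fun l hl ↦ csSup_eq_of_forall_le_of_forall_lt_exists_gt
    ⟨fstar - 1, (hk 1 one_pos).mono hl⟩ (fun γ hγ ↦ ?_) fun w hw ↦ ?_⟩
  · have := InIQ1Trunc.eval_nonneg hγ hz hzq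
    rw [map_sub, eval_C, hzF] at this
    linarith
  · exact ⟨fstar - (fstar - w) / 2, (hk _ (half_pos (sub_pos.2 hw))).mono hl, by linarith⟩
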